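/- Let B be a strongly abelian algebra and θ a congruence on B such that C(1,1;θ) holds in B. Suppose (p,q,r,s) is a 1,1-matrix of B witnessed as p = t(a,u), q = t(a,v), r = t(b,u), s = t(b,v) with q θ r and ¬(r θ s). Let C be the substructure of B × B generated by the diagonal D = {(z,z) | z ∈ B} together with the pairs (u_j, v_j) for all j, and let γ be the smallest congruence of C containing the pair ((p,q),(r,s)). Then the quotient algebra C/γ is not abelian. -/

import Mathlib

namespace UA

/-- An algebraic language: a type of operation symbols with arities. -/
structure Lang where
  F : Type
  arity : F → ℕ

variable {L : Lang}

/-- An interpretation of the language `L` on the carrier `A` (an algebra structure). -/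
def Interp (L : Lang) (A : Type) : Type :=
  (f : L.F) → ((Fin (L.arity f)) → A) → A

/-- Terms of the language `L` over a type `X` of variables. -/
inductive Term (L : Lang) (X : Type) : Type
  | var : X → Term L X
  | app : (f : L.F) → ((Fin (L.arity f)) → Term L X) → Term L X

/-- Realization of a term under an assignment of the variables. -/
def Term.realize {A X : Type} (I : Interp L A) (v : X → A) : Term L X → A
  | .var x => v x
  | .app f ts => I f (fun i => (ts i).realize I v)

/-- Relabelling (substitution of variables) of terms. -/
def Term.relabel {X Y : Type} (g : X → Y) : Term L X → Term L Y
  | .var x => .var (g x)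
  | .app f ts => .app f (fun i => (ts i).relabel g)

/-- `p` is a polynomial operation of the algebra `(A, I)` with argument-index type `X`:
it is the realization of a term in variables `X ⊕ Fin m` where the `Fin m` variables
are evaluated at fixed constants. -/
def IsPolyOp {A X : Type} (I : Interp L A) (p : (X → A) → A) : Prop :=
  ∃ (m : ℕ) (t : Term L (X ⊕ Fin m)) (c : Fin m → A),
    ∀ x : X → A, p x = t.realize I (Sum.elim x c)

/-- A unary polynomial operation. -/
def IsUnaryPolyOp {A : Type} (I : Interp L A) (g : A → A) : Prop :=
  IsPolyOp I (fun x : Fin 1 → A => g (x 0))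

/-- `(p, q, r, s)` is a `1,1`-matrix of the algebra `(A, I)`. -/
def Is11Matrix {A : Type} (I : Interp L A) (p q r s : A) : Prop :=
  ∃ (k l : ℕ) (t : ((Fin k ⊕ Fin l) → A) → A), IsPolyOp I t ∧
    ∃ (a b : Fin k → A) (u v : Fin l → A),
      p = t (Sum.elim a u) ∧ q = t (Sum.elim a v) ∧
      r = t (Sum.elim b u) ∧ s = t (Sum.elim b v)

/-- The algebra is abelian: in every `1,1`-matrix, `p = q` implies `r = s`. -/
def IsAbelian {A : Type} (I : Interp L A) : Prop :=
  ∀ p q r s : A, Is11Matrix I p q r s → p = q → r = s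

/-- The algebra is strongly rectangular: in every `1,1`-matrix, `q = r` implies `r = s`. -/
def IsStronglyRectangular {A : Type} (I : Interp L A) : Prop :=
  ∀ p q r s : A, Is11Matrix I p q r s → q = r → r = s

/-- Strongly abelian = abelian + strongly rectangular. -/
def IsStronglyAbelian {A : Type} (I : Interp L A) : Prop :=
  IsAbelian I ∧ IsStronglyRectangular I

/-- The algebra has a Maltsev polynomial operation. -/
def HasMaltsevPoly {A : Type} (I : Interp L A) : Prop :=
  ∃ mOp : (Fin 3 → A) → A, IsPolyOp I mOp ∧
    ∀ x y : A, mOp ![x, y, y] = x ∧ mOp ![y, y, x] = x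

/-- Affine = abelian + has a Maltsev polynomial operation. -/
def IsAffine {A : Type} (I : Interp L A) : Prop :=
  IsAbelian I ∧ HasMaltsevPoly I

/-- The algebra satisfies the identity `e.1 ≈ e.2`. -/
def Satisfies {A : Type} (I : Interp L A) (e : Term L ℕ × Term L ℕ) : Prop :=
  ∀ v : ℕ → A, e.1.realize I v = e.2.realize I v

/-- Membership in the variety `Mod(E)` axiomatized by the set `E` of identities. -/
def InVariety {A : Type} (E : Set (Term L ℕ × Term L ℕ)) (I : Interp L A) : Prop :=
  ∀ e ∈ E, Satisfies I e

/-- `θ` is a congruence on the algebra `(A, I)`. -/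
def IsCong {A : Type} (I : Interp L A) (θ : A → A → Prop) : Prop :=
  Equivalence θ ∧
    ∀ (f : L.F) (a b : Fin (L.arity f) → A),
      (∀ i, θ (a i) (b i)) → θ (I f a) (I f b)

/-- `(p, q, r, s)` is a `θ`-matrix of the algebra `(A, I)`. -/
def IsThetaMatrix {A : Type} (I : Interp L A) (θ : A → A → Prop) (p q r s : A) : Prop :=
  ∃ (k l : ℕ) (t : ((Fin k ⊕ Fin l) → A) → A), IsPolyOp I t ∧
    ∃ (a b : Fin k → A) (u v : Fin l → A),
      (∀ i, θ (a i) (b i)) ∧ (∀ j, θ (u j) (v j)) ∧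
      p = t (Sum.elim a u) ∧ q = t (Sum.elim a v) ∧
      r = t (Sum.elim b u) ∧ s = t (Sum.elim b v)

/-- `θ` is a strongly abelian congruence. -/
def IsStronglyAbelianCong {A : Type} (I : Interp L A) (θ : A → A → Prop) : Prop :=
  ∀ p q r s : A, IsThetaMatrix I θ p q r s → (p = q → r = s) ∧ (q = r → r = s)

/-- `S` is a subuniverse of the algebra `(A, I)`. -/
def IsSubuniverse {A : Type} (I : Interp L A) (S : Set A) : Prop :=
  ∀ (f : L.F) (a : Fin (L.arity f) → A), (∀ i, a i ∈ S) → I f a ∈ S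

/-- The substructure (restricted algebra structure) on a subuniverse. -/
def subInterp {A : Type} (I : Interp L A) (S : Set A) (hS : IsSubuniverse I S) :
    Interp L S :=
  fun f a => ⟨I f (fun i => (a i : A)), hS f _ (fun i => (a i).2)⟩

/-- The componentwise algebra structure on a product. -/
def prodInterp {ι : Type} {A : ι → Type} (I : ∀ i, Interp L (A i)) :
    Interp L (∀ i, A i) :=
  fun f a i => I i f (fun j => a j i)

/-- The componentwise algebra structure on `A × A`. -/
def pairInterp {A : Type} (I : Interp L A) : Interp L (A × A) :=
  fun f a => (I f (fun i => (a i).1), I f (fun i => (a i).2))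

/-- `h` is a homomorphism of `L`-algebras. -/
def IsHom {A B : Type} (I : Interp L A) (J : Interp L B) (h : A → B) : Prop :=
  ∀ (f : L.F) (a : Fin (L.arity f) → A), h (I f a) = J f (fun i => h (a i))

/-- The induced algebra structure on the quotient by a congruence `ρ`
(well-defined, i.e. independent of the chosen representatives, when `ρ` is a congruence). -/
noncomputable def quotInterp {A : Type} (I : Interp L A) (ρ : A → A → Prop) :
    Interp L (Quot ρ) :=
  fun f a => Quot.mk ρ (I f (fun i => (a i).out))

/-- The subuniverse generated by a subset `G`: the intersection of all
subuniverses containing `G`. -/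
def GenSub {A : Type} (I : Interp L A) (G : Set A) : Set A :=
  {x | ∀ S : Set A, IsSubuniverse I S → G ⊆ S → x ∈ S}

theorem genSub_isSubuniverse {A : Type} (I : Interp L A) (G : Set A) :
    IsSubuniverse I (GenSub I G) :=
  fun f a ha S hS hG => hS f a (fun i => ha i S hS hG)

/-- The smallest congruence containing the pair `(x, y)`: the intersection of all
congruences containing it. -/
def genCong {A : Type} (I : Interp L A) (x y : A) : A → A → Prop :=
  fun w z => ∀ ρ : A → A → Prop, IsCong I ρ → ρ x y → ρ w z

/-- The carrier of `A(θ)`, the graph of `θ` inside `A × A`. -/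
abbrev ThetaSub {A : Type} (θ : A → A → Prop) : Type := {z : A × A // θ z.1 z.2}

/-- The substructure `A(θ) ≤ A × A` supported by the graph of `θ`. -/
def thetaSubInterp {A : Type} (I : Interp L A) (θ : A → A → Prop) (hθ : IsCong I θ) :
    Interp L (ThetaSub θ) :=
  fun f a => ⟨(I f (fun i => (a i).1.1), I f (fun i => (a i).1.2)),
    hθ.2 f _ _ (fun i => (a i).2)⟩

/-- The diagonal element `(c, c)` of `A(θ)`. -/
def diagEl {A : Type} {θ : A → A → Prop} (hrefl : ∀ a : A, θ a a) (c : A) :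
    ThetaSub θ := ⟨(c, c), hrefl c⟩

/-- `Δ`: the smallest congruence of `A(θ)` containing `D × D`, where `D` is the
diagonal -- the intersection of all congruences of `A(θ)` containing `D × D`. -/
def DeltaRel {A : Type} (I : Interp L A) (θ : A → A → Prop) (hθ : IsCong I θ) :
    ThetaSub θ → ThetaSub θ → Prop :=
  fun x y => ∀ ρ : ThetaSub θ → ThetaSub θ → Prop,
    IsCong (thetaSubInterp I θ hθ) ρ →
    (∀ c d : A, ρ (diagEl hθ.1.refl c) (diagEl hθ.1.refl d)) → ρ x y

/-- The quotient algebra `S = A(θ)/Δ`. -/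
noncomputable def SInterp {A : Type} (I : Interp L A) (θ : A → A → Prop)
    (hθ : IsCong I θ) : Interp L (Quot (DeltaRel I θ hθ)) :=
  quotInterp (thetaSubInterp I θ hθ) (DeltaRel I θ hθ)

/-- The element `0` of `S = A(θ)/Δ`: the `Δ`-class of a diagonal element. -/
def zeroS {A : Type} (I : Interp L A) (θ : A → A → Prop) (hθ : IsCong I θ) (d : A) :
    Quot (DeltaRel I θ hθ) :=
  Quot.mk _ (diagEl hθ.1.refl d)

/-- The diagonal of `B × B`. -/
def diagSet (B : Type) : Set (B × B) := {z | z.1 = z.2}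

/-- The set of pairs `(u j, v j)`. -/
def pairsSet {B : Type} {l : ℕ} (u v : Fin l → B) : Set (B × B) :=
  {z | ∃ j, z = (u j, v j)}

/-- The carrier of the subalgebra `C ≤ B × B` generated by the diagonal and the
pairs `(u j, v j)`. -/
def CsetOf {L : Lang} {B : Type} (I : Interp L B) {l : ℕ} (u v : Fin l → B) :
    Set (B × B) :=
  GenSub (pairInterp I) (diagSet B ∪ pairsSet u v)

/-- The subalgebra `C ≤ B × B` generated by the diagonal and the pairs `(u j, v j)`. -/
def CInterpOf {L : Lang} {B : Type} (I : Interp L B) {l : ℕ} (u v : Fin l → B) :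
    Interp L (CsetOf I u v) :=
  subInterp (pairInterp I) _ (genSub_isSubuniverse _ _)


/-- Simultaneous substitution of terms for the variables of a term. -/
def Term.subst {X Y : Type} (g : X → Term L Y) : Term L X → Term L Y
  | .var x => g x
  | .app f ts => .app f (fun i => (ts i).subst g)

theorem Term.realize_relabel {A X Y : Type} (I : Interp L A) (g : X → Y) (w : Y → A)
    (T : Term L X) : (T.relabel g).realize I w = T.realize I (w ∘ g) := by
  induction T with
  | var x => rfl
  | app f ts ih => simp only [Term.relabel, Term.realize, ih]

theorem Term.realize_subst {A X Y : Type} (I : Interp L A) (g : X → Term L Y) (w : Y → A)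
    (T : Term L X) : (T.subst g).realize I w = T.realize I (fun x => (g x).realize I w) := by
  induction T with
  | var x => rfl
  | app f ts ih => simp only [Term.subst, Term.realize, ih]

theorem Term.relabel_relabel {X Y Z : Type} (g : X → Y) (h : Y → Z) (T : Term L X) :
    (T.relabel g).relabel h = T.relabel (h ∘ g) := by
  induction T with
  | var x => rfl
  | app f ts ih => simp only [Term.relabel, ih]

/-- Every term involves only finitely many variables. -/
theorem Term.exists_relabel_fin {X : Type} (T : Term L X) :
    ∃ (n : ℕ) (T' : Term L (Fin n)) (g : Fin n → X), T = T'.relabel g := by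
  induction T with
  | var x => exact ⟨1, .var 0, fun _ => x, rfl⟩
  | app f ts ih =>
    choose n T' g h using ih
    let e := Fintype.equivFin (Σ i, Fin (n i))
    refine ⟨_, .app f (fun i => (T' i).relabel fun j => e ⟨i, j⟩),
      fun j => g (e.symm j).1 (e.symm j).2, ?_⟩
    simp only [Term.relabel, Term.relabel_relabel, Term.app.injEq, heq_eq_eq, true_and]
    funext i
    rw [h i]
    congr 1
    funext j
    change _ = g (e.symm (e ⟨i, j⟩)).1 (e.symm (e ⟨i, j⟩)).2
    rw [e.symm_apply_apply]

theorem IsHom.map_realize {A A' X : Type} {I : Interp L A} {J : Interp L A'} {h : A → A'}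
    (hh : IsHom I J h) (w : X → A) (T : Term L X) :
    h (T.realize I w) = T.realize J (h ∘ w) := by
  induction T with
  | var x => rfl
  | app f ts ih => simp only [Term.realize, hh f, ih]

theorem IsCong.realize {A X : Type} {I : Interp L A} {θ : A → A → Prop} (hθ : IsCong I θ)
    {w w' : X → A} (h : ∀ x, θ (w x) (w' x)) (T : Term L X) :
    θ (T.realize I w) (T.realize I w') := by
  induction T with
  | var x => exact h x
  | app f ts ih => exact hθ.2 f _ _ ih

/-- The values of a term at four assignments form a `1,1`-matrix as soon as each variable
depends either on the row only or on the column only. -/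
theorem is11Matrix_realize {A X : Type} (I : Interp L A) (T : Term L X)
    (w₁ w₂ w₃ w₄ : X → A)
    (h : ∀ x, (w₁ x = w₂ x ∧ w₃ x = w₄ x) ∨ (w₁ x = w₃ x ∧ w₂ x = w₄ x)) :
    Is11Matrix I (T.realize I w₁) (T.realize I w₂) (T.realize I w₃) (T.realize I w₄) := by
  classical
  obtain ⟨n, T', g, rfl⟩ := T.exists_relabel_fin
  let row (i : Fin n) : Prop := w₁ (g i) = w₂ (g i) ∧ w₃ (g i) = w₄ (g i)
  let T'' : Term L ((Fin n ⊕ Fin n) ⊕ Fin 0) :=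
    T'.relabel fun i => if row i then .inl (.inl i) else .inl (.inr i)
  refine ⟨n, n, fun x => T''.realize I (Sum.elim x Fin.elim0),
    ⟨0, T'', Fin.elim0, fun _ => rfl⟩, w₁ ∘ g, w₃ ∘ g, w₁ ∘ g, w₂ ∘ g, ?_, ?_, ?_, ?_⟩
  all_goals
    simp only [T'', Term.realize_relabel]
    congr 1
    funext i
    by_cases hi : row i
    · simp [hi, hi.1, hi.2]
    · simp [hi, (h (g i)).resolve_left hi]

/-- An equivalence relation preserved by changing one argument at a time is preserved by
changing all arguments. -/
theorem equivalence_rel_of_update {ι A A' : Type} [Fintype ι] [DecidableEq ι]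
    {R : A → A → Prop} {R' : A' → A' → Prop} (hR' : Equivalence R') (F : (ι → A) → A')
    (h : ∀ a i x y, R x y → R' (F (Function.update a i x)) (F (Function.update a i y)))
    {a b : ι → A} (hab : ∀ i, R (a i) (b i)) : R' (F a) (F b) := by
  have key : ∀ s : Finset ι, R' (F a) (F (s.piecewise b a)) := by
    intro s
    induction s using Finset.induction_on with
    | empty => simpa using hR'.refl _
    | insert j s hj ih =>
      refine hR'.trans ih ?_
      rw [Finset.piecewise_insert]
      convert h (s.piecewise b a) j (a j) (b j) (hab j) using 2
      rw [← Finset.piecewise_eq_of_notMem s b a hj, Function.update_eq_self]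
  simpa using key Finset.univ

/-- The relation of being sent to `E`-related elements by all unary polynomials. -/
def polyCore {A : Type} (I : Interp L A) (E : A → A → Prop) : A → A → Prop :=
  fun x y => ∀ H : Term L (Option A),
    E (H.realize I fun o => o.elim x id) (H.realize I fun o => o.elim y id)

theorem polyCore_isCong {A : Type} (I : Interp L A) {E : A → A → Prop} (hE : Equivalence E) :
    IsCong I (polyCore I E) := by
  have heq : Equivalence (polyCore I E) :=
    ⟨fun _ _ => hE.refl _, fun h H => hE.symm (h H), fun h h' H => hE.trans (h H) (h' H)⟩
  refine ⟨heq, fun f a b hab => equivalence_rel_of_update heq (I f) ?_ hab⟩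
  intro a i x y hxy H
  let g : Option A → Term L (Option A) := fun o => o.elim
    (.app f (Function.update (fun j => .var (some (a j))) i (.var none))) (fun z => .var (some z))
  have hg (x : A) : (fun o => (g o).realize I fun o => o.elim x id) =
      fun o => o.elim (I f (Function.update a i x)) id := by
    funext o
    cases o with
    | some z => rfl
    | none =>
      simp only [g, Option.elim, Term.realize]
      congr 1
      funext j
      by_cases hj : j = i
      · subst hj; simp [Term.realize]
      · simp [hj, Term.realize]
  have := hxy (H.subst g)
  rwa [Term.realize_subst, Term.realize_subst, hg, hg] at this

theorem genCong_isCong {A : Type} (I : Interp L A) (x y : A) : IsCong I (genCong I x y) :=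
  ⟨⟨fun _ _ hρ _ => hρ.1.refl _, fun h ρ hρ hxy => hρ.1.symm (h ρ hρ hxy),
    fun h h' ρ hρ hxy => hρ.1.trans (h ρ hρ hxy) (h' ρ hρ hxy)⟩,
    fun f _ _ h ρ hρ hxy => hρ.2 f _ _ fun i => h i ρ hρ hxy⟩

theorem IsCong.quot_eq_iff {A : Type} {I : Interp L A} {ρ : A → A → Prop} (hρ : IsCong I ρ)
    {x y : A} : Quot.mk ρ x = Quot.mk ρ y ↔ ρ x y :=
  ⟨fun h => Quotient.exact (s := ⟨ρ, hρ.1⟩) h, Quot.sound⟩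

theorem IsCong.isHom_mk {A : Type} {I : Interp L A} {ρ : A → A → Prop} (hρ : IsCong I ρ) :
    IsHom I (quotInterp I ρ) (Quot.mk ρ) :=
  fun f _ => Quot.sound (hρ.2 f _ _ fun _ => hρ.quot_eq_iff.1 (Quot.out_eq _).symm)

/-- Two pairs are related if both are off the diagonal, or both are on the diagonal with
`θ`-related entries. -/
def diagRel {B : Type} (θ : B → B → Prop) (z w : B × B) : Prop :=
  (z.1 = z.2 ↔ w.1 = w.2) ∧ (z.1 = z.2 → θ z.1 w.1)

theorem diagRel_equivalence {B : Type} {θ : B → B → Prop} (hθ : Equivalence θ) :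
    Equivalence (diagRel θ) where
  refl _ := ⟨Iff.rfl, fun _ => hθ.refl _⟩
  symm h := ⟨h.1.symm, fun e => hθ.symm (h.2 (h.1.2 e))⟩
  trans h h' := ⟨h.1.trans h'.1, fun e => hθ.trans (h.2 e) (h'.2 (h.1.1 e))⟩

/-- In a strongly abelian algebra, for a term operation `H` and polynomial `t`,
`(H(t(a,u),w), H(t(a,v),w'))` and `(H(t(b,u),w), H(t(b,v),w'))` are `diagRel θ`-related
whenever `t(a,v) θ t(b,u)`. -/
theorem diagRel_realize {B C : Type} {I : Interp L B} (hB : IsStronglyAbelian I)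
    {θ : B → B → Prop} (hθ : IsCong I θ) {k l : ℕ} {t : ((Fin k ⊕ Fin l) → B) → B}
    (ht : IsPolyOp I t) (a b : Fin k → B) (u v : Fin l → B)
    (hqr : θ (t (Sum.elim a v)) (t (Sum.elim b u))) (H : Term L (Option C)) (w w' : C → B) :
    diagRel θ
      (H.realize I fun o => o.elim (t (Sum.elim a u)) w,
        H.realize I fun o => o.elim (t (Sum.elim a v)) w')
      (H.realize I fun o => o.elim (t (Sum.elim b u)) w,
        H.realize I fun o => o.elim (t (Sum.elim b v)) w') := by
  obtain ⟨m, τ, c, hτ⟩ := ht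
  let K : Term L (((Fin k ⊕ Fin l) ⊕ Fin m) ⊕ C) :=
    H.subst fun o => o.elim (τ.relabel .inl) (fun z => .var (.inr z))
  have hK (α : Fin k → B) (β : Fin l → B) (w : C → B) :
      (H.realize I fun o => o.elim (t (Sum.elim α β)) w) =
        K.realize I (Sum.elim (Sum.elim (Sum.elim α β) c) w) := by
    simp only [K, Term.realize_subst]
    congr 1
    funext o
    cases o with
    | none => simp [hτ, Term.realize_relabel]
    | some z => rfl
  have habel (α α' : Fin k → B)
      (h : (H.realize I fun o => o.elim (t (Sum.elim α u)) w) =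
        H.realize I fun o => o.elim (t (Sum.elim α v)) w') :
      (H.realize I fun o => o.elim (t (Sum.elim α' u)) w) =
        H.realize I fun o => o.elim (t (Sum.elim α' v)) w' := by
    rw [hK, hK] at h ⊢
    refine hB.1 _ _ _ _ (is11Matrix_realize I K _ _ _ _ ?_) h
    rintro (((i | j) | i) | z) <;> simp
  refine ⟨⟨habel a b, habel b a⟩, fun h => ?_⟩
  have hrect : (H.realize I fun o => o.elim (t (Sum.elim a v)) w') =
      H.realize I fun o => o.elim (t (Sum.elim a v)) w := by
    simp only [hK] at h ⊢
    refine hB.2 (K.realize I (Sum.elim (Sum.elim (Sum.elim a u) c) w')) _ _ _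
      (is11Matrix_realize I K _ _ _ _ ?_) h
    rintro (((i | j) | i) | z) <;> simp
  simp only at h ⊢
  rw [h, hrect]
  refine hθ.realize (fun o => ?_) H
  cases o with
  | none => exact hqr
  | some z => exact hθ.1.refl _

theorem isHom_subInterp_fst {B : Type} (I : Interp L B) {S : Set (B × B)}
    (hS : IsSubuniverse (pairInterp I) S) :
    IsHom (subInterp (pairInterp I) S hS) I (fun z => z.1.1) :=
  fun _ _ => rfl

theorem isHom_subInterp_snd {B : Type} (I : Interp L B) {S : Set (B × B)}
    (hS : IsSubuniverse (pairInterp I) S) :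
    IsHom (subInterp (pairInterp I) S hS) I (fun z => z.1.2) :=
  fun _ _ => rfl

theorem realize_CInterpOf {B X : Type} (I : Interp L B) {l : ℕ} (u v : Fin l → B)
    (w : X → CsetOf I u v) (T : Term L X) :
    (T.realize (CInterpOf I u v) w).1 =
      (T.realize I (fun x => (w x).1.1), T.realize I (fun x => (w x).1.2)) :=
  Prod.ext ((isHom_subInterp_fst I (genSub_isSubuniverse _ _)).map_realize w T)
    ((isHom_subInterp_snd I (genSub_isSubuniverse _ _)).map_realize w T)

theorem diag_mem_CsetOf {B : Type} (I : Interp L B) {l : ℕ} (u v : Fin l → B) (z : B) :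
    (z, z) ∈ CsetOf I u v :=
  fun _ _ hG => hG (Or.inl rfl)

theorem pair_mem_CsetOf {B : Type} (I : Interp L B) {l : ℕ} (u v : Fin l → B) (j : Fin l) :
    (u j, v j) ∈ CsetOf I u v :=
  fun _ _ hG => hG (Or.inr ⟨j, rfl⟩)

/-- Let `B` be strongly abelian, `θ` a congruence with `C(1,1;θ)`, and
`(p,q,r,s)` a witnessed `1,1`-matrix with `q θ r` and `¬(r θ s)`. Let `C ≤ B × B` be
generated by the diagonal and the pairs `(u j, v j)`, and `γ` the smallest congruence of
`C` containing `((p,q),(r,s))`. Then `C/γ` is not abelian. -/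
theorem statement15 {L : Lang} {B : Type} (I : Interp L B)
    (hB : IsStronglyAbelian I)
    (θ : B → B → Prop) (hθ : IsCong I θ)
    (hC11 : ∀ p q r s : B, Is11Matrix I p q r s → θ p q → θ r s)
    {k l : ℕ} (t : ((Fin k ⊕ Fin l) → B) → B) (ht : IsPolyOp I t)
    (a b : Fin k → B) (u v : Fin l → B)
    (p q r s : B)
    (hp : p = t (Sum.elim a u)) (hq : q = t (Sum.elim a v))
    (hr : r = t (Sum.elim b u)) (hs : s = t (Sum.elim b v))
    (hqr : θ q r) (hrs : ¬ θ r s)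
    (hpq : ((p, q) : B × B) ∈ CsetOf I u v)
    (hrsm : ((r, s) : B × B) ∈ CsetOf I u v) :
    ¬ IsAbelian (quotInterp (CInterpOf I u v)
      (genCong (CInterpOf I u v) ⟨(p, q), hpq⟩ ⟨(r, s), hrsm⟩)) := by
  intro hab
  set x : CsetOf I u v := ⟨(p, q), hpq⟩
  set y : CsetOf I u v := ⟨(r, s), hrsm⟩
  set J := CInterpOf I u v with hJ
  have hγ := genCong_isCong J x y
  let d (z : B) : CsetOf I u v := ⟨(z, z), diag_mem_CsetOf I u v z⟩
  have hqs : genCong J x y (d q) (d s) := by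
    obtain ⟨m, τ, c, hτ⟩ := ht
    let e (j : Fin l) : CsetOf I u v := ⟨(u j, v j), pair_mem_CsetOf I u v j⟩
    let W (α : Fin k → B) (β : Fin l → CsetOf I u v) :
        (Fin k ⊕ Fin l) ⊕ Fin m → CsetOf I u v :=
      Sum.elim (Sum.elim (d ∘ α) β) (d ∘ c)
    have hW (α : Fin k → B) (β : Fin l → CsetOf I u v) :
        (τ.realize J (W α β)).1 =
          (t (Sum.elim α fun j => (β j).1.1), t (Sum.elim α fun j => (β j).1.2)) := by
      rw [hJ, realize_CInterpOf, hτ, hτ]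
      congr 2 <;> (funext i; rcases i with (i | j) | i <;> rfl)
    have hM := is11Matrix_realize (quotInterp J (genCong J x y)) τ
      (Quot.mk _ ∘ W a e) (Quot.mk _ ∘ W b e)
      (Quot.mk _ ∘ W a (d ∘ v)) (Quot.mk _ ∘ W b (d ∘ v))
      (by rintro ((i | j) | i) <;> simp [W])
    simp only [← hγ.isHom_mk.map_realize] at hM
    have ha : τ.realize J (W a e) = x := Subtype.ext ((hW _ _).trans (Prod.ext hp.symm hq.symm))
    have hb : τ.realize J (W b e) = y := Subtype.ext ((hW _ _).trans (Prod.ext hr.symm hs.symm))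
    have ha' : τ.realize J (W a (d ∘ v)) = d q := Subtype.ext ((hW _ _).trans (Prod.ext hq.symm hq.symm))
    have hb' : τ.realize J (W b (d ∘ v)) = d s := Subtype.ext ((hW _ _).trans (Prod.ext hs.symm hs.symm))
    rw [ha, hb, ha', hb'] at hM
    exact hγ.quot_eq_iff.1 (hab _ _ _ _ hM (Quot.sound fun _ _ h => h))
  let E : CsetOf I u v → CsetOf I u v → Prop := fun z w => diagRel θ z.1 w.1
  have hE : Equivalence E :=
    ⟨fun _ => (diagRel_equivalence hθ.1).refl _, fun h => (diagRel_equivalence hθ.1).symm h,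
      fun h h' => (diagRel_equivalence hθ.1).trans h h'⟩
  have hxy : polyCore J E x y := by
    intro H
    have h := diagRel_realize hB hθ ht a b u v (hq ▸ hr ▸ hqr) H
      (fun z : CsetOf I u v => z.1.1) (fun z => z.1.2)
    rw [← hp, ← hq, ← hr, ← hs] at h
    simp only [E]
    rw [hJ, realize_CInterpOf, realize_CInterpOf]
    convert h using 4 <;> (rename_i o; cases o <;> rfl)
  have hfin : θ q s := (hqs _ (polyCore_isCong J hE) hxy (.var none)).2 rfl
  exact hrs (hθ.1.trans (hθ.1.symm hqr) hfin)

end UA
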